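/- Let α_1, ..., α_{q−1} be the distinct nonzero elements of F_q, let 1 ≤ s ≤ q−1, and let V_q(s) be the s×(q−1) Vandermonde matrix whose (i,j) entry is α_j^{i−1}. For each i with 1 ≤ i ≤ s, the linear code spanned by the first i rows of V_q(s) has length q−1, dimension i, and minimum distance exactly q − i. Consequently, for linear codes C_0, ..., C_{s−1} ⊆ F_q^n of dimensions k_0, ..., k_{s−1} and minimum distances d_0, ..., d_{s−1}, the matrix-product code C = [C_0, ..., C_{s−1}]V_q(s) has length (q−1)n, dimension k_0 + ... + k_{s−1}, and minimum distance at least min over i ∈ {0, ..., s−1} of (q − i − 1)d_i. -/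

import Mathlib

open scoped Pointwise

/-- Hamming weight of a vector. -/
noncomputable def wt {ι F : Type*} [Fintype ι] [Zero F] (x : ι → F) : ℕ :=
  letI := Classical.decEq F
  (Finset.univ.filter fun i => x i ≠ 0).card

/-- Minimum distance (= minimum weight) of a code given as a set. -/
noncomputable def minDist {ι F : Type*} [Fintype ι] [Zero F] (C : Set (ι → F)) : ℕ :=
  sInf (wt '' {x ∈ C | x ≠ 0})

/-- The matrix-product code `[C_1, …, C_s]A`, a subspace of `F^{l·n}`: the codeword
corresponding to `(c_1,…,c_s)` has `(j,k)` entry `∑ i, A i j * (c i) k`. -/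
noncomputable def matrixProdCode {F : Type*} [Field F] {n s l : ℕ}
    (C : Fin s → Submodule F (Fin n → F)) (A : Matrix (Fin s) (Fin l) F) :
    Submodule F (Fin l × Fin n → F) :=
  Submodule.map
    (show (Fin s → Fin n → F) →ₗ[F] (Fin l × Fin n → F) from
      { toFun := fun c (jk : Fin l × Fin n) => ∑ i, A i jk.1 * c i jk.2
        map_add' := by
          intro a b; funext jk
          simp [mul_add, Finset.sum_add_distrib]
        map_smul' := by
          intro r a; funext jk
          simp [Finset.mul_sum, mul_left_comm] })
    (Submodule.pi Set.univ C)

open Polynomial in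
/-- A polynomial of degree at most `d` with coefficient vector `c ≠ 0`, evaluated at `N` distinct
points, takes at least `N - d` nonzero values. -/
theorem le_add_wt_sum_mul_pow {F : Type*} [Field F] {m N d : ℕ} {α : Fin N → F}
    (hα : Function.Injective α) {c : Fin m → F} (hc : c ≠ 0)
    (hd : ∀ r : Fin m, d < r → c r = 0) :
    N ≤ d + wt fun j => ∑ r : Fin m, c r * α j ^ (r : ℕ) := by
  classical
  set p : F[X] := ∑ r : Fin m, C (c r) * X ^ (r : ℕ) with hp
  have hcoeff (r : Fin m) : p.coeff r = c r := by
    simp [hp, Polynomial.coeff_X_pow, Fin.val_inj]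
  have hp0 : p ≠ 0 := by
    rintro h
    exact hc (funext fun r => by simp [← hcoeff, h])
  have hdeg : p.natDegree ≤ d := by
    refine Polynomial.natDegree_sum_le_of_forall_le _ _ fun r _ => ?_
    by_cases h : d < r
    · simp [hd r h]
    · exact (Polynomial.natDegree_C_mul_X_pow_le _ _).trans (not_lt.mp h)
  have heval (j : Fin N) : p.eval (α j) = ∑ r : Fin m, c r * α j ^ (r : ℕ) := by
    simp [hp, Polynomial.eval_finsetSum]
  have hroots : (Finset.univ.filter fun j => p.eval (α j) = 0).card ≤ d := by
    rw [← Finset.card_image_of_injective _ hα]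
    refine (Polynomial.card_le_degree_of_subset_roots (p := p) fun x hx => ?_).trans hdeg
    simp only [Finset.mem_val, Finset.mem_image, Finset.mem_filter_univ] at hx
    obtain ⟨j, hj, rfl⟩ := hx
    simp [hp0, hj]
  have hsplit := Finset.card_filter_add_card_filter_not (s := (Finset.univ : Finset (Fin N)))
    (fun j => p.eval (α j) = 0)
  simp only [Finset.card_univ, Fintype.card_fin] at hsplit
  simp only [wt, ← heval]
  convert hsplit.symm.le.trans (Nat.add_le_add_right hroots _)

theorem wt_zero {ι F : Type*} [Fintype ι] [Zero F] : wt (0 : ι → F) = 0 := by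
  simp [wt]

theorem minDist_le_wt {ι F : Type*} [Fintype ι] [Zero F] {C : Set (ι → F)} {x : ι → F}
    (hx : x ∈ C) (hx0 : x ≠ 0) : minDist C ≤ wt x :=
  Nat.sInf_le ⟨x, ⟨hx, hx0⟩, rfl⟩

theorem exists_wt_eq_minDist {ι F : Type*} [Fintype ι] [Zero F] {C : Set (ι → F)}
    (hC : ∃ x ∈ C, x ≠ 0) : ∃ x ∈ C, x ≠ 0 ∧ wt x = minDist C := by
  obtain ⟨x, hx, hx0⟩ := hC
  obtain ⟨y, ⟨hy, hy0⟩, h⟩ := Nat.sInf_mem (s := wt '' {x ∈ C | x ≠ 0}) ⟨_, x, ⟨hx, hx0⟩, rfl⟩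
  exact ⟨y, hy, hy0, h⟩

theorem minDist_bot {ι F : Type*} [Fintype ι] [Field F] :
    minDist ((⊥ : Submodule F (ι → F)) : Set (ι → F)) = 0 := by
  have : {x ∈ ((⊥ : Submodule F (ι → F)) : Set (ι → F)) | x ≠ 0} = ∅ := by
    ext x; simp
  rw [minDist, this, Set.image_empty, Nat.sInf_empty]

/-- A coefficient vector is zero if the polynomial vanishes at enough distinct points. -/
theorem eq_zero_of_sum_mul_pow_eq_zero {F : Type*} [Field F] {m N : ℕ} {α : Fin N → F}
    (hα : Function.Injective α) (hm : m ≤ N) {c : Fin m → F}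
    (h : ∀ j, ∑ r : Fin m, c r * α j ^ (r : ℕ) = 0) : c = 0 := by
  by_contra hc
  obtain ⟨r, -⟩ := Function.ne_iff.mp hc
  have := le_add_wt_sum_mul_pow (d := m - 1) hα hc fun r hr => by omega
  rw [show (fun j => ∑ r : Fin m, c r * α j ^ (r : ℕ)) = 0 from funext h, wt_zero] at this
  have := r.isLt
  omega

theorem linearIndependent_pow_rows {F : Type*} [Field F] {m N : ℕ} {α : Fin N → F}
    (hα : Function.Injective α) (hm : m ≤ N) :
    LinearIndependent F fun (r : Fin m) (j : Fin N) => α j ^ (r : ℕ) := by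
  rw [Fintype.linearIndependent_iff]
  intro c hc
  refine congrFun (eq_zero_of_sum_mul_pow_eq_zero hα hm fun j => ?_)
  simpa using congrFun hc j

theorem mem_span_pow_rows {F : Type*} [Field F] {m N : ℕ} {α : Fin N → F} {x : Fin N → F} :
    x ∈ Submodule.span F (Set.range fun (r : Fin m) (j : Fin N) => α j ^ (r : ℕ)) ↔
      ∃ c : Fin m → F, (fun j => ∑ r : Fin m, c r * α j ^ (r : ℕ)) = x := by
  rw [Submodule.mem_span_range_iff_exists_fun]
  refine exists_congr fun c => ?_
  rw [show ∑ r, c r • (fun j => α j ^ (r : ℕ)) = fun j => ∑ r : Fin m, c r * α j ^ (r : ℕ) from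
    funext fun j => by simp]

open Polynomial in
/-- The evaluation vector of the polynomial vanishing exactly at the first `m` points is a codeword
of weight at most `N - m`. -/
theorem exists_mem_span_pow_rows_wt_le {F : Type*} [Field F] {m N : ℕ} (α : Fin N → F)
    (hm : m < N) (hα : Function.Injective α) :
    ∃ x ∈ Submodule.span F (Set.range fun (r : Fin (m + 1)) (j : Fin N) => α j ^ (r : ℕ)),
      x ≠ 0 ∧ wt x ≤ N - m := by
  classical
  set p : F[X] := ∏ t : Fin m, (X - C (α (t.castLE hm.le))) with hp
  have hdeg : p.natDegree = m := by
    rw [hp, natDegree_prod_of_monic _ _ fun t _ => monic_X_sub_C _]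
    simp
  refine ⟨fun j => p.eval (α j), mem_span_pow_rows.mpr ⟨fun r => p.coeff r, ?_⟩, ?_, ?_⟩
  · funext j
    rw [eval_eq_sum_range, hdeg, Fin.sum_univ_eq_sum_range (fun r => p.coeff r * α j ^ r)]
  · refine Function.ne_iff.mpr ⟨⟨m, hm⟩, ?_⟩
    simp only [hp, eval_prod, eval_sub, eval_X, eval_C, Pi.zero_apply, Finset.prod_ne_zero_iff]
    intro t _
    rw [sub_ne_zero, hα.ne_iff, Ne, Fin.ext_iff]
    exact t.isLt.ne'
  · have hzero (t : Fin m) : p.eval (α (t.castLE hm.le)) = 0 := by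
      rw [hp, eval_prod]
      exact Finset.prod_eq_zero (Finset.mem_univ t) (by simp)
    have hsub : (Finset.univ.filter fun j => p.eval (α j) ≠ 0) ⊆
        (Finset.univ.image (Fin.castLE hm.le))ᶜ := by
      intro j hj
      simp only [Finset.mem_filter_univ] at hj
      simp only [Finset.mem_compl, Finset.mem_image, Finset.mem_univ, true_and, not_exists]
      rintro t rfl
      exact hj (hzero t)
    have hcard := Finset.card_le_card hsub
    rw [Finset.card_compl, Finset.card_image_of_injective _ (Fin.castLE_injective _)] at hcard
    simp only [Finset.card_univ, Fintype.card_fin] at hcard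
    unfold wt
    convert hcard

theorem minDist_span_pow_rows {F : Type*} [Field F] {m N : ℕ} {α : Fin N → F}
    (hm : m < N) (hα : Function.Injective α) :
    minDist (Submodule.span F (Set.range fun (r : Fin (m + 1)) (j : Fin N) => α j ^ (r : ℕ)) :
      Set (Fin N → F)) = N - m := by
  obtain ⟨x, hx, hx0, hwt⟩ := exists_mem_span_pow_rows_wt_le α hm hα
  refine ((minDist_le_wt hx hx0).trans hwt).antisymm ?_
  obtain ⟨y, hy, hy0, h⟩ := exists_wt_eq_minDist ⟨x, hx, hx0⟩
  obtain ⟨c, rfl⟩ := mem_span_pow_rows.mp hy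
  have hc : c ≠ 0 := by
    rintro rfl
    exact hy0 (funext fun j => by simp)
  rw [← h]
  have := le_add_wt_sum_mul_pow (d := m) hα hc fun r hr => by omega
  omega

/-- The linear map `(c_i) ↦ (∑ i, A i j * c_i)` whose image on `∏ C_i` is the matrix-product
code. -/
def matrixProdMap {F : Type*} [Field F] {s l : ℕ} (n : ℕ) (A : Matrix (Fin s) (Fin l) F) :
    (Fin s → Fin n → F) →ₗ[F] (Fin l × Fin n → F) where
  toFun c jk := ∑ i, A i jk.1 * c i jk.2
  map_add' a b := by
    funext jk
    simp [mul_add, Finset.sum_add_distrib]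
  map_smul' r a := by
    funext jk
    simp [Finset.mul_sum, mul_left_comm]

theorem matrixProdCode_eq_map {F : Type*} [Field F] {n s l : ℕ}
    (C : Fin s → Submodule F (Fin n → F)) (A : Matrix (Fin s) (Fin l) F) :
    matrixProdCode C A = (Submodule.pi Set.univ C).map (matrixProdMap n A) :=
  rfl

theorem matrixProdMap_vandermonde_injective {F : Type*} [Field F] {n s N : ℕ} {α : Fin N → F}
    (hα : Function.Injective α) (hs : s ≤ N) :
    Function.Injective
      (matrixProdMap n (Matrix.of fun (i : Fin s) (j : Fin N) => α j ^ (i : ℕ))) := by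
  rw [injective_iff_map_eq_zero]
  intro c hc
  funext i k
  refine congrFun (eq_zero_of_sum_mul_pow_eq_zero (c := fun i => c i k) hα hs fun j => ?_) i
  simpa [matrixProdMap, mul_comm] using congrFun hc (j, k)

theorem finrank_pi_univ {F ι : Type*} [Field F] [Fintype ι] {M : ι → Type*}
    [∀ i, AddCommGroup (M i)] [∀ i, Module F (M i)] [∀ i, FiniteDimensional F (M i)]
    (C : ∀ i, Submodule F (M i)) :
    Module.finrank F (Submodule.pi Set.univ C) = ∑ i, Module.finrank F (C i) := by
  rw [← Module.finrank_pi_fintype F]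
  exact LinearEquiv.finrank_eq
    { toFun := fun x i => ⟨x.1 i, x.2 i trivial⟩
      invFun := fun y => ⟨fun i => y i, fun i _ => (y i).2⟩
      map_add' := fun _ _ => rfl
      map_smul' := fun _ _ => rfl
      left_inv := fun _ => rfl
      right_inv := fun _ => rfl }

theorem wt_prod {ι κ F : Type*} [Fintype ι] [Fintype κ] [Zero F] (x : ι × κ → F) :
    wt x = ∑ k, wt fun j => x (j, k) := by
  classical
  simp only [wt, Finset.card_filter, Fintype.sum_prod_type_right]

/-- Lower bound for the weight of a matrix-product codeword whose components after `c i` vanish. -/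
theorem mul_wt_le_wt_matrixProdMap {F : Type*} [Field F] {n s N : ℕ} {α : Fin N → F}
    (hα : Function.Injective α) (c : Fin s → Fin n → F) (i : Fin s) (hi : ∀ r, i < r → c r = 0) :
    (N - i) * wt (c i) ≤
      wt (matrixProdMap n (Matrix.of fun (i : Fin s) (j : Fin N) => α j ^ (i : ℕ)) c) := by
  classical
  rw [wt_prod, wt, Finset.card_filter, Finset.mul_sum]
  refine Finset.sum_le_sum fun k _ => ?_
  by_cases hk : c i k = 0
  · simp [hk]
  · have := le_add_wt_sum_mul_pow (c := fun r => c r k) (d := i) hα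
      (Function.ne_iff.mpr ⟨i, hk⟩) fun r hr => congrFun (hi r hr) k
    simp only [matrixProdMap, LinearMap.coe_mk, AddHom.coe_mk, Matrix.of_apply]
    simp only [mul_comm (c _ k)] at this
    simp only [hk, ne_eq, not_false_eq_true, if_true, mul_one]
    omega

theorem iInf_le_minDist_matrixProdCode {F : Type*} [Field F] {n s N : ℕ} {α : Fin N → F}
    (hs : 0 < s) (hα : Function.Injective α) (hsN : s ≤ N)
    (C : Fin s → Submodule F (Fin n → F)) :
    ⨅ i : Fin s, (N - (i : ℕ)) * minDist (C i : Set (Fin n → F)) ≤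
      minDist (matrixProdCode C (Matrix.of fun (i : Fin s) (j : Fin N) => α j ^ (i : ℕ)) :
        Set (Fin N × Fin n → F)) := by
  classical
  by_cases h0 : C ⟨0, hs⟩ = ⊥
  · refine (ciInf_le' _ ⟨0, hs⟩).trans ?_
    rw [h0, minDist_bot, mul_zero]
    exact Nat.zero_le _
  have hinj := matrixProdMap_vandermonde_injective (n := n) hα hsN
  rw [matrixProdCode_eq_map]
  obtain ⟨v, hv, hv0⟩ := Submodule.exists_mem_ne_zero_of_ne_bot h0
  have hsingle : Pi.single ⟨0, hs⟩ v ∈ Submodule.pi Set.univ C := by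
    intro i _
    obtain rfl | hi := eq_or_ne i ⟨0, hs⟩
    · simpa using hv
    · simp [hi]
  obtain ⟨x, ⟨c, hc, rfl⟩, hx0, hx⟩ := exists_wt_eq_minDist
    (C := ((Submodule.pi Set.univ C).map
      (matrixProdMap n (Matrix.of fun (i : Fin s) (j : Fin N) => α j ^ (i : ℕ))) :
        Set (Fin N × Fin n → F)))
    ⟨_, ⟨Pi.single ⟨0, hs⟩ v, hsingle, rfl⟩,
      by rwa [Ne, map_eq_zero_iff _ hinj, Pi.single_eq_zero_iff]⟩
  have hc0 : c ≠ 0 := by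
    rintro rfl
    exact hx0 (map_zero _)
  obtain ⟨i₀, hi₀⟩ := Function.ne_iff.mp hc0
  obtain ⟨i, hi, hmax⟩ := (Finset.univ.filter fun i => c i ≠ 0).exists_max_image id
    ⟨i₀, by simpa using hi₀⟩
  simp only [Finset.mem_filter_univ, id] at hi hmax
  rw [← hx]
  calc ⨅ i : Fin s, (N - (i : ℕ)) * minDist (C i : Set (Fin n → F))
      ≤ (N - (i : ℕ)) * minDist (C i : Set (Fin n → F)) := ciInf_le' _ i
    _ ≤ (N - i) * wt (c i) := Nat.mul_le_mul_left _ (minDist_le_wt (hc i trivial) hi)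
    _ ≤ _ := mul_wt_le_wt_matrixProdMap hα c i fun r hr => by
      by_contra h
      exact (hmax r h).not_gt hr

/-- Let `V_q(s)` be the `s × (q-1)` Vandermonde matrix built from the
distinct nonzero elements `α_j` of `F_q`. The code spanned by its first `i` rows
(`1 ≤ i ≤ s`) has length `q-1`, dimension `i` and minimum distance exactly `q - i`.
Consequently `C = [C_0,…,C_{s-1}]V_q(s)` has length `(q-1)n`, dimension
`k_0 + ⋯ + k_{s-1}` and minimum distance at least `min_i (q - i - 1) d_i`. -/
theorem vandermonde_matrixProdCode_params
    {F : Type*} [Field F] [Fintype F] {n s : ℕ}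
    (hs : 0 < s) (hsq : s ≤ Fintype.card F - 1)
    (α : Fin (Fintype.card F - 1) → F)
    (hαinj : Function.Injective α) (hα0 : ∀ j, α j ≠ 0)
    (C : Fin s → Submodule F (Fin n → F)) :
    (∀ i : ℕ, 1 ≤ i → i ≤ s →
      Module.finrank F
          (Submodule.span F (Set.range fun r : Fin i =>
            fun j : Fin (Fintype.card F - 1) => α j ^ (r : ℕ))) = i ∧
      minDist ((Submodule.span F (Set.range fun r : Fin i =>
            fun j : Fin (Fintype.card F - 1) => α j ^ (r : ℕ)) :
          Submodule F (Fin (Fintype.card F - 1) → F)) : Set (Fin (Fintype.card F - 1) → F)) =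
        Fintype.card F - i) ∧
    Fintype.card (Fin (Fintype.card F - 1) × Fin n) = (Fintype.card F - 1) * n ∧
    Module.finrank F
        (matrixProdCode C
          (Matrix.of fun (i : Fin s) (j : Fin (Fintype.card F - 1)) => α j ^ (i : ℕ))) =
      ∑ i, Module.finrank F (C i) ∧
    ⨅ i : Fin s, (Fintype.card F - (i : ℕ) - 1) * minDist (C i : Set (Fin n → F)) ≤
      minDist (matrixProdCode C
          (Matrix.of fun (i : Fin s) (j : Fin (Fintype.card F - 1)) => α j ^ (i : ℕ)) :
        Set (Fin (Fintype.card F - 1) × Fin n → F)) := by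
  refine ⟨fun i hi his => ⟨?_, ?_⟩, by simp, ?_, ?_⟩
  · rw [finrank_span_eq_card (linearIndependent_pow_rows hαinj (his.trans hsq)),
      Fintype.card_fin]
  · obtain ⟨m, rfl⟩ := Nat.exists_eq_add_of_le' hi
    rw [minDist_span_pow_rows (by omega) hαinj]
    omega
  · rw [matrixProdCode_eq_map, ← finrank_pi_univ]
    exact (Submodule.equivMapOfInjective _
      (matrixProdMap_vandermonde_injective hαinj hsq) _).finrank_eq.symm
  · simpa only [Nat.sub_right_comm] using iInf_le_minDist_matrixProdCode hs hαinj hsq C
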